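/- Theorem (consistency of the pole): for every closed term t there is a stack π such that t ∗ π ∉ ⫫. -/

import Mathlib

namespace CBV

/-! ## Syntax: values, terms, stacks, processes of the call-by-value λμ-calculus.
    λ-variables, μ-variables, term variables, labels and constructors are all
    represented by natural numbers. -/

mutual
  /-- Values: `x`, `λx.t`, `C[v]`, `{lᵢ = vᵢ}`. -/
  inductive Val : Type where
    | var : ℕ → Val                      -- λ-variable x
    | lam : ℕ → Trm → Val                -- λx.t
    | cns : ℕ → Val → Val                -- C[v]
    | rcd : Flds → Val                   -- {lᵢ = vᵢ}
  /-- Record fields: a finite list of (label, value) pairs. -/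
  inductive Flds : Type where
    | nil : Flds
    | cons : ℕ → Val → Flds → Flds
  /-- Terms: `a`, `v`, `t u`, `μα.t`, `p`, `v.l`, `case_v [Cᵢ[xᵢ] → tᵢ]`, `δ_{v,w}`. -/
  inductive Trm : Type where
    | tvar : ℕ → Trm                     -- term variable a
    | val : Val → Trm
    | app : Trm → Trm → Trm
    | mu : ℕ → Trm → Trm                 -- μα.t
    | prc : Proc → Trm
    | prj : Val → ℕ → Trm                -- v.l
    | cse : Val → Brs → Trm              -- case_v [...]
    | dlt : Val → Val → Trm              -- δ_{v,w}
  /-- Case branches: a finite list of (constructor, bound λ-variable, body). -/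
  inductive Brs : Type where
    | nil : Brs
    | cons : ℕ → ℕ → Trm → Brs → Brs
  /-- Stacks: `α`, `v.π`, `[t]π`. -/
  inductive Stk : Type where
    | svar : ℕ → Stk                     -- stack (μ-)variable α
    | push : Val → Stk → Stk             -- v.π
    | frame : Trm → Stk → Stk            -- [t]π
  /-- Processes: `t ∗ π`. -/
  inductive Proc : Type where
    | mk : Trm → Stk → Proc
end

/-- Lookup of a label in a record. -/
def Flds.lookup : Flds → ℕ → Option Val
  | .nil, _ => none
  | .cons l v fs, k => if l = k then some v else fs.lookup k

/-- Lookup of a constructor among case branches, returning the bound variable and body. -/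
def Brs.lookup : Brs → ℕ → Option (ℕ × Trm)
  | .nil, _ => none
  | .cons c x t bs, k => if c = k then some (x, t) else bs.lookup k

/-- A substitution maps λ-variables to values, μ-variables to stacks and
    term variables to terms (totally; the identity outside its support). -/
structure Subst : Type where
  lamS : ℕ → Val
  muS  : ℕ → Stk
  trmS : ℕ → Trm

/-- The identity substitution. -/
def Subst.id : Subst := ⟨Val.var, Stk.svar, Trm.tvar⟩

/-- The substitution [x := v] of a single λ-variable. -/
def subst1Lam (x : ℕ) (v : Val) : Subst :=
  { Subst.id with lamS := Function.update Val.var x v }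

/-- The substitution [α := π] of a single μ-variable. -/
def subst1Mu (α : ℕ) (π : Stk) : Subst :=
  { Subst.id with muS := Function.update Stk.svar α π }

/-- The substitution [a := t] of a single term variable. -/
def subst1Trm (a : ℕ) (t : Trm) : Subst :=
  { Subst.id with trmS := Function.update Trm.tvar a t }

/-- Remove a λ-variable from the support of a substitution (used under binders). -/
def Subst.skipLam (σ : Subst) (x : ℕ) : Subst :=
  { σ with lamS := Function.update σ.lamS x (Val.var x) }

/-- Remove a μ-variable from the support of a substitution (used under binders). -/
def Subst.skipMu (σ : Subst) (α : ℕ) : Subst :=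
  { σ with muS := Function.update σ.muS α (Stk.svar α) }

mutual
  /-- Application of a substitution to a value. -/
  def substVal (σ : Subst) : Val → Val
    | .var x => σ.lamS x
    | .lam x t => .lam x (substTrm (σ.skipLam x) t)
    | .cns c v => .cns c (substVal σ v)
    | .rcd fs => .rcd (substFlds σ fs)
  /-- Application of a substitution to record fields. -/
  def substFlds (σ : Subst) : Flds → Flds
    | .nil => .nil
    | .cons l v fs => .cons l (substVal σ v) (substFlds σ fs)
  /-- Application of a substitution to a term. -/
  def substTrm (σ : Subst) : Trm → Trm
    | .tvar a => σ.trmS a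
    | .val v => .val (substVal σ v)
    | .app t u => .app (substTrm σ t) (substTrm σ u)
    | .mu α t => .mu α (substTrm (σ.skipMu α) t)
    | .prc p => .prc (substPrc σ p)
    | .prj v l => .prj (substVal σ v) l
    | .cse v bs => .cse (substVal σ v) (substBrs σ bs)
    | .dlt v w => .dlt (substVal σ v) (substVal σ w)
  /-- Application of a substitution to case branches. -/
  def substBrs (σ : Subst) : Brs → Brs
    | .nil => .nil
    | .cons c x t bs => .cons c x (substTrm (σ.skipLam x) t) (substBrs σ bs)
  /-- Application of a substitution to a stack. -/
  def substStk (σ : Subst) : Stk → Stk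
    | .svar α => σ.muS α
    | .push v π => .push (substVal σ v) (substStk σ π)
    | .frame t π => .frame (substTrm σ t) (substStk σ π)
  /-- Application of a substitution to a process. -/
  def substPrc (σ : Subst) : Proc → Proc
    | .mk t π => .mk (substTrm σ t) (substStk σ π)
end

/-! ## The reduction relation (≻). -/

/-- The reduction relation (≻) of the Krivine abstract machine. -/
inductive Red : Proc → Proc → Prop where
  | app (t u : Trm) (π : Stk) :
      Red (.mk (.app t u) π) (.mk u (.frame t π))
  | frame (v : Val) (t : Trm) (π : Stk) :
      Red (.mk (.val v) (.frame t π)) (.mk t (.push v π))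
  | beta (x : ℕ) (t : Trm) (v : Val) (π : Stk) :
      Red (.mk (.val (.lam x t)) (.push v π)) (.mk (substTrm (subst1Lam x v) t) π)
  | mu (α : ℕ) (t : Trm) (π : Stk) :
      Red (.mk (.mu α t) π) (.mk (substTrm (subst1Mu α π) t) π)
  | prc (p : Proc) (π : Stk) :
      Red (.mk (.prc p) π) p
  | prj (fs : Flds) (l : ℕ) (v : Val) (π : Stk) :
      fs.lookup l = some v →
      Red (.mk (.prj (.rcd fs) l) π) (.mk (.val v) π)
  | cse (c : ℕ) (v : Val) (bs : Brs) (x : ℕ) (t : Trm) (π : Stk) :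
      bs.lookup c = some (x, t) →
      Red (.mk (.cse (.cns c v) bs) π) (.mk (substTrm (subst1Lam x v) t) π)

/-- k-fold application of a relation. -/
def iterRel (R : Proc → Proc → Prop) : ℕ → Proc → Proc → Prop
  | 0 => Eq
  | k + 1 => fun p r => ∃ q, R p q ∧ iterRel R k q r

/-- A process is final if it is of the form `v ∗ α`. -/
def Final (p : Proc) : Prop :=
  ∃ (v : Val) (α : ℕ), p = .mk (.val v) (.svar α)

/-- A process is δ-like if it is of the form `δ_{v,w} ∗ π`. -/
def DeltaLike (p : Proc) : Prop :=
  ∃ (v w : Val) (π : Stk), p = .mk (.dlt v w) π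

/-- A process is blocked if it has no (≻)-reduct. -/
def Blocked (p : Proc) : Prop := ¬ ∃ q, Red p q

/-- A process is stuck if it is neither final nor δ-like, and all its
    substitution instances are blocked. -/
def Stuck (p : Proc) : Prop :=
  ¬ Final p ∧ ¬ DeltaLike p ∧ ∀ σ : Subst, Blocked (substPrc σ p)

/-- A process is non-terminating if it reaches no blocked process. -/
def NonTerminating (p : Proc) : Prop :=
  ¬ ∃ q, Relation.ReflTransGen Red p q ∧ Blocked q

/-- `p ⇓_R`: the process `p` converges for the reduction relation `R`,
    i.e. it `R`-reduces to a final process. -/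
def ConvergesIn (R : Proc → Proc → Prop) (p : Proc) : Prop :=
  ∃ q, Relation.ReflTransGen R p q ∧ Final q

/-- The indexed reduction relation (↪ᵢ) = (≻) ∪ {(δ_{v,w} ∗ π, v ∗ π) | ∃ j < i, v ≢ⱼ w}.
    (The condition `v ≢ⱼ w` is inlined; it coincides with `¬ EquivI j v w` below.) -/
def RedI : ℕ → Proc → Proc → Prop
  | i => fun p q =>
      Red p q ∨
      ∃ (v w : Val) (π : Stk), p = .mk (.dlt v w) π ∧ q = .mk (.val v) π ∧
        ∃ j, ∃ _ : j < i,
          ¬ (∀ k, ∀ _ : k ≤ j, ∀ (π' : Stk) (σ : Subst),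
              ConvergesIn (RedI k) (.mk (substTrm σ (.val v)) π') ↔
              ConvergesIn (RedI k) (.mk (substTrm σ (.val w)) π'))
  termination_by i => i
  decreasing_by omega

/-- The indexed observational equivalence (≡ᵢ). -/
def EquivI (i : ℕ) (t u : Trm) : Prop :=
  ∀ j, j ≤ i → ∀ (π : Stk) (σ : Subst),
    ConvergesIn (RedI j) (.mk (substTrm σ t) π) ↔
    ConvergesIn (RedI j) (.mk (substTrm σ u) π)

/-- The reduction relation (↪) = ∪ᵢ (↪ᵢ). -/
def RedFull (p q : Proc) : Prop := ∃ i, RedI i p q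

/-- Observational equivalence (≡) = ∩ᵢ (≡ᵢ). -/
def Equiv (t u : Trm) : Prop := ∀ i, EquivI i t u

/-! ## The pole and orthogonality. -/

/-- The pole ⫫ = {p | p ⇓_↪}. -/
def Pole : Set Proc := {p | ConvergesIn RedFull p}

/-- Orthogonal of a set of values: φ^⊥ = {π | ∀ v ∈ φ, v ∗ π ∈ ⫫}. -/
def orth (φ : Set Val) : Set Stk :=
  {π | ∀ v ∈ φ, Proc.mk (.val v) π ∈ Pole}

/-- Bi-orthogonal of a set of values: φ^⊥⊥ = {t | ∀ π ∈ φ^⊥, t ∗ π ∈ ⫫}. -/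
def biorth (φ : Set Val) : Set Trm :=
  {t | ∀ π ∈ orth φ, Proc.mk t π ∈ Pole}

/-! ## Free variables and closedness. -/

/-- The kinds of variables: λ-variables, μ-variables, term variables,
    predicate variables. -/
inductive VKind : Type where
  | lam | mu | trm | prd
deriving DecidableEq

mutual
  /-- Free variables (of every kind) of a value. -/
  def fvVal : Val → Set (VKind × ℕ)
    | .var x => {(VKind.lam, x)}
    | .lam x t => fvTrm t \ {(VKind.lam, x)}
    | .cns _ v => fvVal v
    | .rcd fs => fvFlds fs
  /-- Free variables of record fields. -/
  def fvFlds : Flds → Set (VKind × ℕ)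
    | .nil => ∅
    | .cons _ v fs => fvVal v ∪ fvFlds fs
  /-- Free variables of a term. -/
  def fvTrm : Trm → Set (VKind × ℕ)
    | .tvar a => {(VKind.trm, a)}
    | .val v => fvVal v
    | .app t u => fvTrm t ∪ fvTrm u
    | .mu α t => fvTrm t \ {(VKind.mu, α)}
    | .prc p => fvPrc p
    | .prj v _ => fvVal v
    | .cse v bs => fvVal v ∪ fvBrs bs
    | .dlt v w => fvVal v ∪ fvVal w
  /-- Free variables of case branches. -/
  def fvBrs : Brs → Set (VKind × ℕ)
    | .nil => ∅
    | .cons _ x t bs => (fvTrm t \ {(VKind.lam, x)}) ∪ fvBrs bs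
  /-- Free variables of a stack. -/
  def fvStk : Stk → Set (VKind × ℕ)
    | .svar α => {(VKind.mu, α)}
    | .push v π => fvVal v ∪ fvStk π
    | .frame t π => fvTrm t ∪ fvStk π
  /-- Free variables of a process. -/
  def fvPrc : Proc → Set (VKind × ℕ)
    | .mk t π => fvTrm t ∪ fvStk π
end

/-- A term is closed if it contains no free variable of any kind. -/
def ClosedTrm (t : Trm) : Prop := fvTrm t = ∅

end CBV

namespace CBV

/-! ## Processes whose stacks are guarded

A process is guarded when every free μ-variable outside a set `S` occurs only below a frame
`[a]π` with `a` a term variable. Firing such a frame blocks the machine, so a process that is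
guarded relative to `∅` never becomes final. -/

mutual
  /-- Values guarded relative to `S`. -/
  def GuardedVal (S : Set ℕ) : Val → Prop
    | .var _ => True
    | .lam _ t => GuardedTrm S t
    | .cns _ v => GuardedVal S v
    | .rcd fs => GuardedFlds S fs
  /-- Record fields guarded relative to `S`. -/
  def GuardedFlds (S : Set ℕ) : Flds → Prop
    | .nil => True
    | .cons _ v fs => GuardedVal S v ∧ GuardedFlds S fs
  /-- Terms guarded relative to `S`. -/
  def GuardedTrm (S : Set ℕ) : Trm → Prop
    | .tvar _ => True
    | .val v => GuardedVal S v
    | .app t u => GuardedTrm S t ∧ GuardedTrm S u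
    | .mu α t => GuardedTrm (insert α S) t
    | .prc p => GuardedPrc S p
    | .prj v _ => GuardedVal S v
    | .cse v bs => GuardedVal S v ∧ GuardedBrs S bs
    | .dlt v w => GuardedVal S v ∧ GuardedVal S w
  /-- Case branches guarded relative to `S`. -/
  def GuardedBrs (S : Set ℕ) : Brs → Prop
    | .nil => True
    | .cons _ _ t bs => GuardedTrm S t ∧ GuardedBrs S bs
  /-- Stacks guarded relative to `S`. -/
  def GuardedStk (S : Set ℕ) : Stk → Prop
    | .svar α => α ∈ S
    | .push v π => GuardedVal S v ∧ GuardedStk S π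
    | .frame t π => (∃ a, t = .tvar a) ∨ (GuardedTrm S t ∧ GuardedStk S π)
  /-- Processes guarded relative to `S`. -/
  def GuardedPrc (S : Set ℕ) : Proc → Prop
    | .mk t π => (∃ a, t = .tvar a) ∨ (GuardedTrm S t ∧ GuardedStk S π)
end

mutual
  theorem GuardedVal.mono {S T : Set ℕ} (hST : S ⊆ T) :
      ∀ v : Val, GuardedVal S v → GuardedVal T v
    | .var _, _ => trivial
    | .lam _ t, h => GuardedTrm.mono hST t h
    | .cns _ v, h => GuardedVal.mono hST v h
    | .rcd fs, h => GuardedFlds.mono hST fs h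
  theorem GuardedFlds.mono {S T : Set ℕ} (hST : S ⊆ T) :
      ∀ fs : Flds, GuardedFlds S fs → GuardedFlds T fs
    | .nil, _ => trivial
    | .cons _ v fs, h => ⟨GuardedVal.mono hST v h.1, GuardedFlds.mono hST fs h.2⟩
  theorem GuardedTrm.mono {S T : Set ℕ} (hST : S ⊆ T) :
      ∀ t : Trm, GuardedTrm S t → GuardedTrm T t
    | .tvar _, _ => trivial
    | .val v, h => GuardedVal.mono hST v h
    | .app t u, h => ⟨GuardedTrm.mono hST t h.1, GuardedTrm.mono hST u h.2⟩
    | .mu _ t, h => GuardedTrm.mono (Set.insert_subset_insert hST) t h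
    | .prc p, h => GuardedPrc.mono hST p h
    | .prj v _, h => GuardedVal.mono hST v h
    | .cse v bs, h => ⟨GuardedVal.mono hST v h.1, GuardedBrs.mono hST bs h.2⟩
    | .dlt v w, h => ⟨GuardedVal.mono hST v h.1, GuardedVal.mono hST w h.2⟩
  theorem GuardedBrs.mono {S T : Set ℕ} (hST : S ⊆ T) :
      ∀ bs : Brs, GuardedBrs S bs → GuardedBrs T bs
    | .nil, _ => trivial
    | .cons _ _ t bs, h => ⟨GuardedTrm.mono hST t h.1, GuardedBrs.mono hST bs h.2⟩
  theorem GuardedStk.mono {S T : Set ℕ} (hST : S ⊆ T) :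
      ∀ π : Stk, GuardedStk S π → GuardedStk T π
    | .svar _, h => hST h
    | .push v π, h => ⟨GuardedVal.mono hST v h.1, GuardedStk.mono hST π h.2⟩
    | .frame t π, h =>
      h.imp id fun h => ⟨GuardedTrm.mono hST t h.1, GuardedStk.mono hST π h.2⟩
  theorem GuardedPrc.mono {S T : Set ℕ} (hST : S ⊆ T) :
      ∀ p : Proc, GuardedPrc S p → GuardedPrc T p
    | .mk t π, h =>
      h.imp id fun h => ⟨GuardedTrm.mono hST t h.1, GuardedStk.mono hST π h.2⟩
end

/-- A substitution that fixes term variables, sends λ-variables to values guarded relative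
to `T`, and sends the μ-variables of `S` to stacks guarded relative to `T`. -/
structure Subst.Guarded (σ : Subst) (S T : Set ℕ) : Prop where
  lamS : ∀ x, GuardedVal T (σ.lamS x)
  muS : ∀ α ∈ S, GuardedStk T (σ.muS α)
  trmS : ∀ a, σ.trmS a = .tvar a

theorem Subst.Guarded.skipLam {σ : Subst} {S T : Set ℕ} (hσ : σ.Guarded S T) (x : ℕ) :
    (σ.skipLam x).Guarded S T where
  lamS y := by
    by_cases hy : y = x
    · subst hy
      simp [Subst.skipLam, GuardedVal]
    · simpa [Subst.skipLam, hy] using hσ.lamS y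
  muS := hσ.muS
  trmS := hσ.trmS

theorem Subst.Guarded.skipMu {σ : Subst} {S T : Set ℕ} (hσ : σ.Guarded S T) (α : ℕ) :
    (σ.skipMu α).Guarded (insert α S) (insert α T) where
  lamS x := GuardedVal.mono (Set.subset_insert α T) _ (hσ.lamS x)
  muS β hβ := by
    by_cases hβα : β = α
    · subst hβα
      simp [Subst.skipMu, GuardedStk]
    · have hβS : β ∈ S := hβ.resolve_left hβα
      simpa [Subst.skipMu, hβα] using
        GuardedStk.mono (Set.subset_insert α T) _ (hσ.muS β hβS)
  trmS := hσ.trmS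

theorem subst1Lam_guarded (x : ℕ) {v : Val} {S : Set ℕ} (hv : GuardedVal S v) :
    (subst1Lam x v).Guarded S S where
  lamS y := by
    by_cases hy : y = x
    · subst hy
      simpa [subst1Lam] using hv
    · simp [subst1Lam, hy, GuardedVal]
  muS _ h := h
  trmS _ := rfl

theorem subst1Mu_guarded (α : ℕ) {π : Stk} {S : Set ℕ} (hπ : GuardedStk S π) :
    (subst1Mu α π).Guarded (insert α S) S where
  lamS _ := trivial
  muS β hβ := by
    by_cases hβα : β = α
    · subst hβα
      simpa [subst1Mu] using hπ
    · simpa [subst1Mu, hβα, GuardedStk] using hβ.resolve_left hβα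
  trmS _ := rfl

theorem Subst.Guarded.exists_substTrm_eq_tvar {σ : Subst} {S T : Set ℕ} (hσ : σ.Guarded S T)
    {t : Trm} (ht : ∃ a, t = .tvar a) : ∃ a, substTrm σ t = .tvar a := by
  obtain ⟨a, rfl⟩ := ht
  exact ⟨a, hσ.trmS a⟩

mutual
  theorem GuardedVal.subst {σ : Subst} {S T : Set ℕ} (hσ : σ.Guarded S T) :
      ∀ v : Val, GuardedVal S v → GuardedVal T (substVal σ v)
    | .var x, _ => hσ.lamS x
    | .lam x t, h => GuardedTrm.subst (hσ.skipLam x) t h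
    | .cns _ v, h => GuardedVal.subst hσ v h
    | .rcd fs, h => GuardedFlds.subst hσ fs h
  theorem GuardedFlds.subst {σ : Subst} {S T : Set ℕ} (hσ : σ.Guarded S T) :
      ∀ fs : Flds, GuardedFlds S fs → GuardedFlds T (substFlds σ fs)
    | .nil, _ => trivial
    | .cons _ v fs, h => ⟨GuardedVal.subst hσ v h.1, GuardedFlds.subst hσ fs h.2⟩
  theorem GuardedTrm.subst {σ : Subst} {S T : Set ℕ} (hσ : σ.Guarded S T) :
      ∀ t : Trm, GuardedTrm S t → GuardedTrm T (substTrm σ t)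
    | .tvar a, _ => by
      rw [substTrm, hσ.trmS a]
      trivial
    | .val v, h => GuardedVal.subst hσ v h
    | .app t u, h => ⟨GuardedTrm.subst hσ t h.1, GuardedTrm.subst hσ u h.2⟩
    | .mu α t, h => GuardedTrm.subst (hσ.skipMu α) t h
    | .prc p, h => GuardedPrc.subst hσ p h
    | .prj v _, h => GuardedVal.subst hσ v h
    | .cse v bs, h => ⟨GuardedVal.subst hσ v h.1, GuardedBrs.subst hσ bs h.2⟩
    | .dlt v w, h => ⟨GuardedVal.subst hσ v h.1, GuardedVal.subst hσ w h.2⟩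
  theorem GuardedBrs.subst {σ : Subst} {S T : Set ℕ} (hσ : σ.Guarded S T) :
      ∀ bs : Brs, GuardedBrs S bs → GuardedBrs T (substBrs σ bs)
    | .nil, _ => trivial
    | .cons _ x t bs, h =>
      ⟨GuardedTrm.subst (hσ.skipLam x) t h.1, GuardedBrs.subst hσ bs h.2⟩
  theorem GuardedStk.subst {σ : Subst} {S T : Set ℕ} (hσ : σ.Guarded S T) :
      ∀ π : Stk, GuardedStk S π → GuardedStk T (substStk σ π)
    | .svar α, h => hσ.muS α h
    | .push v π, h => ⟨GuardedVal.subst hσ v h.1, GuardedStk.subst hσ π h.2⟩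
    | .frame t π, h =>
      h.imp hσ.exists_substTrm_eq_tvar fun h =>
        ⟨GuardedTrm.subst hσ t h.1, GuardedStk.subst hσ π h.2⟩
  theorem GuardedPrc.subst {σ : Subst} {S T : Set ℕ} (hσ : σ.Guarded S T) :
      ∀ p : Proc, GuardedPrc S p → GuardedPrc T (substPrc σ p)
    | .mk t π, h =>
      h.imp hσ.exists_substTrm_eq_tvar fun h =>
        ⟨GuardedTrm.subst hσ t h.1, GuardedStk.subst hσ π h.2⟩
end

mutual
  theorem guardedVal_of_fv {S : Set ℕ} :
      ∀ v : Val, (∀ α, (VKind.mu, α) ∈ fvVal v → α ∈ S) → GuardedVal S v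
    | .var _, _ => trivial
    | .lam _ t, h => guardedTrm_of_fv t fun α hα => h α ⟨hα, by simp⟩
    | .cns _ v, h => guardedVal_of_fv v h
    | .rcd fs, h => guardedFlds_of_fv fs h
  theorem guardedFlds_of_fv {S : Set ℕ} :
      ∀ fs : Flds, (∀ α, (VKind.mu, α) ∈ fvFlds fs → α ∈ S) → GuardedFlds S fs
    | .nil, _ => trivial
    | .cons _ v fs, h =>
      ⟨guardedVal_of_fv v fun α hα => h α (.inl hα),
        guardedFlds_of_fv fs fun α hα => h α (.inr hα)⟩
  theorem guardedTrm_of_fv {S : Set ℕ} :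
      ∀ t : Trm, (∀ α, (VKind.mu, α) ∈ fvTrm t → α ∈ S) → GuardedTrm S t
    | .tvar _, _ => trivial
    | .val v, h => guardedVal_of_fv v h
    | .app t u, h =>
      ⟨guardedTrm_of_fv t fun α hα => h α (.inl hα),
        guardedTrm_of_fv u fun α hα => h α (.inr hα)⟩
    | .mu α t, h => guardedTrm_of_fv t fun β hβ =>
      or_iff_not_imp_left.2 fun hne => h β ⟨hβ, by simpa using hne⟩
    | .prc p, h => guardedPrc_of_fv p h
    | .prj v _, h => guardedVal_of_fv v h
    | .cse v bs, h =>
      ⟨guardedVal_of_fv v fun α hα => h α (.inl hα),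
        guardedBrs_of_fv bs fun α hα => h α (.inr hα)⟩
    | .dlt v w, h =>
      ⟨guardedVal_of_fv v fun α hα => h α (.inl hα),
        guardedVal_of_fv w fun α hα => h α (.inr hα)⟩
  theorem guardedBrs_of_fv {S : Set ℕ} :
      ∀ bs : Brs, (∀ α, (VKind.mu, α) ∈ fvBrs bs → α ∈ S) → GuardedBrs S bs
    | .nil, _ => trivial
    | .cons _ _ t bs, h =>
      ⟨guardedTrm_of_fv t fun α hα => h α (.inl ⟨hα, by simp⟩),
        guardedBrs_of_fv bs fun α hα => h α (.inr hα)⟩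
  theorem guardedStk_of_fv {S : Set ℕ} :
      ∀ π : Stk, (∀ α, (VKind.mu, α) ∈ fvStk π → α ∈ S) → GuardedStk S π
    | .svar α, h => h α rfl
    | .push v π, h =>
      ⟨guardedVal_of_fv v fun α hα => h α (.inl hα),
        guardedStk_of_fv π fun α hα => h α (.inr hα)⟩
    | .frame t π, h =>
      .inr ⟨guardedTrm_of_fv t fun α hα => h α (.inl hα),
        guardedStk_of_fv π fun α hα => h α (.inr hα)⟩
  theorem guardedPrc_of_fv {S : Set ℕ} :
      ∀ p : Proc, (∀ α, (VKind.mu, α) ∈ fvPrc p → α ∈ S) → GuardedPrc S p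
    | .mk t π, h =>
      .inr ⟨guardedTrm_of_fv t fun α hα => h α (.inl hα),
        guardedStk_of_fv π fun α hα => h α (.inr hα)⟩
end

theorem GuardedFlds.of_lookup {S : Set ℕ} {l : ℕ} {v : Val} :
    ∀ {fs : Flds}, GuardedFlds S fs → fs.lookup l = some v → GuardedVal S v
  | .nil, _, hl => by simp [Flds.lookup] at hl
  | .cons k w fs, h, hl => by
    rw [Flds.lookup] at hl
    split_ifs at hl
    · exact Option.some.inj hl ▸ h.1
    · exact GuardedFlds.of_lookup h.2 hl

theorem GuardedBrs.of_lookup {S : Set ℕ} {c x : ℕ} {t : Trm} :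
    ∀ {bs : Brs}, GuardedBrs S bs → bs.lookup c = some (x, t) → GuardedTrm S t
  | .nil, _, hl => by simp [Brs.lookup] at hl
  | .cons d y u bs, h, hl => by
    rw [Brs.lookup] at hl
    split_ifs at hl
    · obtain ⟨rfl, rfl⟩ := Prod.mk.inj (Option.some.inj hl)
      exact h.1
    · exact GuardedBrs.of_lookup h.2 hl

theorem GuardedPrc.red {S : Set ℕ} {p q : Proc} (h : GuardedPrc S p) (hpq : Red p q) :
    GuardedPrc S q := by
  cases hpq with
  | app t u π =>
    obtain ⟨_, ⟨⟩⟩ | ⟨h, hπ⟩ := h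
    exact .inr ⟨h.2, .inr ⟨h.1, hπ⟩⟩
  | frame v t π =>
    obtain ⟨_, ⟨⟩⟩ | ⟨hv, hπ⟩ := h
    exact hπ.imp id fun hπ => ⟨hπ.1, hv, hπ.2⟩
  | beta x t v π =>
    obtain ⟨_, ⟨⟩⟩ | ⟨h, hπ⟩ := h
    exact .inr ⟨GuardedTrm.subst (subst1Lam_guarded x hπ.1) t h, hπ.2⟩
  | mu α t π =>
    obtain ⟨_, ⟨⟩⟩ | ⟨h, hπ⟩ := h
    exact .inr ⟨GuardedTrm.subst (subst1Mu_guarded α hπ) t h, hπ⟩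
  | prc p π =>
    obtain ⟨_, ⟨⟩⟩ | ⟨h, hπ⟩ := h
    exact h
  | prj fs l v π hl =>
    obtain ⟨_, ⟨⟩⟩ | ⟨h, hπ⟩ := h
    exact .inr ⟨GuardedFlds.of_lookup h hl, hπ⟩
  | cse c v bs x t π hl =>
    obtain ⟨_, ⟨⟩⟩ | ⟨h, hπ⟩ := h
    have hv : GuardedVal S v := h.1
    exact .inr ⟨GuardedTrm.subst (subst1Lam_guarded x hv) t (h.2.of_lookup hl), hπ⟩

theorem GuardedPrc.redFull {S : Set ℕ} {p q : Proc} (h : GuardedPrc S p)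
    (hpq : RedFull p q) : GuardedPrc S q := by
  obtain ⟨i, hi⟩ := hpq
  rw [RedI] at hi
  obtain hi | ⟨v, w, π, rfl, rfl, -⟩ := hi
  · exact h.red hi
  · obtain ⟨_, ⟨⟩⟩ | ⟨h, hπ⟩ := h
    exact .inr ⟨h.1, hπ⟩

theorem GuardedPrc.not_final {p : Proc} (h : GuardedPrc ∅ p) : ¬ Final p := by
  rintro ⟨v, α, rfl⟩
  obtain ⟨_, ⟨⟩⟩ | ⟨-, hα⟩ := h
  exact hα

theorem GuardedPrc.notMem_pole {p : Proc} (h : GuardedPrc ∅ p) : p ∉ Pole := by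
  rintro ⟨q, hpq, hq⟩
  have hguard : GuardedPrc ∅ q := by
    clear hq
    induction hpq with
    | refl => exact h
    | tail _ hstep ih => exact ih.redFull hstep
  exact hguard.not_final hq

/-- Theorem 5 (consistency of the pole): every closed term fails against
    some stack. -/
theorem pole_consistent (t : Trm) (h : ClosedTrm t) :
    ∃ π : Stk, Proc.mk t π ∉ Pole := by
  refine ⟨.frame (.tvar 0) (.svar 0), GuardedPrc.notMem_pole (.inr ⟨?_, .inl ⟨0, rfl⟩⟩)⟩
  refine guardedTrm_of_fv t fun α hα => ?_
  rw [show fvTrm t = ∅ from h] at hα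
  exact hα.elim

end CBV
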